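/- Define $S(n,d) = \sum_{i=0}^{n-1} \frac{1}{1 - \binom{i}{d}/\binom{n}{d}}$ as a real number. Fix a natural number $d \geq 1$. There exists a constant $C > 0$ such that for all natural numbers $n \geq d$ with $n \geq 2$, $$\left| S(n,d) - \frac{n \log n}{d} \right| \;\leq\; C\, n.$$ -/

import Mathlib

noncomputable def S (n d : ℕ) : ℝ :=
  ∑ i ∈ Finset.range n, 1 / (1 - (i.choose d : ℝ) / (n.choose d : ℝ))

/-- Union bound for the number of `d`-subsets meeting a set of size `n - i`. -/
theorem choose_union_bound (e i k : ℕ) :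
    (i + k).choose (e + 1) ≤ i.choose (e + 1) + k * (i + k - 1).choose e := by
  induction k with
  | zero => simp
  | succ k ih =>
    have h1 : (i + (k + 1)).choose (e + 1) = (i + k).choose e + (i + k).choose (e + 1) := by
      rw [← add_assoc, Nat.choose_succ_succ]
    have h2 : (i + k - 1).choose e ≤ (i + k).choose e := Nat.choose_le_choose _ (by omega)
    have h3 : i + (k + 1) - 1 = i + k := by omega
    rw [h1, h3]
    nlinarith

/-- The ratio of binomials is at most the power of the ratio. -/
theorem choose_mul_pow_le (i n d : ℕ) (hin : i ≤ n) :
    i.choose d * n ^ d ≤ n.choose d * i ^ d := by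
  induction d with
  | zero => simp
  | succ d ih =>
    have h1 := Nat.choose_succ_right_eq i d
    have h2 := Nat.choose_succ_right_eq n d
    have h3 : (i - d) * n ≤ (n - d) * i := by
      rw [Nat.sub_mul, Nat.sub_mul, mul_comm i n]
      exact Nat.sub_le_sub_left (Nat.mul_le_mul_left d hin) _
    have h4 := Nat.mul_le_mul ih h3
    refine Nat.le_of_mul_le_mul_right (c := d + 1) ?_ (Nat.succ_pos d)
    calc i.choose (d + 1) * n ^ (d + 1) * (d + 1)
        = (i.choose (d + 1) * (d + 1)) * (n ^ d * n) := by ring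
      _ = i.choose d * n ^ d * ((i - d) * n) := by rw [h1]; ring
      _ ≤ n.choose d * i ^ d * ((n - d) * i) := h4
      _ = (n.choose d * (n - d)) * (i ^ d * i) := by ring
      _ = n.choose (d + 1) * i ^ (d + 1) * (d + 1) := by rw [← h2]; ring

theorem one_sub_pow_le_quad (x : ℝ) (hx : 0 ≤ x) (hx1 : x ≤ 1) (d : ℕ) :
    (1 - x) ^ d ≤ 1 - d * x + d ^ 2 * x ^ 2 := by
  induction d with
  | zero => simp
  | succ d ih =>
    have h := mul_le_mul_of_nonneg_right ih (sub_nonneg.2 hx1)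
    rw [pow_succ]
    refine h.trans ?_
    push_cast
    have hd : (0 : ℝ) ≤ d := Nat.cast_nonneg d
    have h1 : 0 ≤ (d : ℝ) ^ 2 * x ^ 3 := by positivity
    have h2 : 0 ≤ (d : ℝ) * x ^ 2 := by positivity
    nlinarith [sq_nonneg x]

theorem term_bounds (d n i : ℕ) (hd : 1 ≤ d) (hdn : d ≤ n) (hin : i < n) :
    (n : ℝ) / (d * ((n : ℝ) - i)) ≤ 1 / (1 - (i.choose d : ℝ) / (n.choose d : ℝ)) ∧
    1 / (1 - (i.choose d : ℝ) / (n.choose d : ℝ)) ≤ (n : ℝ) / (d * ((n : ℝ) - i)) + d := by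
  have hc : (0 : ℝ) < n.choose d := by exact_mod_cast Nat.choose_pos hdn
  have hn : (0 : ℝ) < n := by exact_mod_cast (by omega : 0 < n)
  have hd0 : (0 : ℝ) < d := by exact_mod_cast hd
  have hi : (i : ℝ) < n := by exact_mod_cast hin
  have hk : (0 : ℝ) < (n : ℝ) - i := by linarith
  obtain ⟨x, hx⟩ : ∃ x : ℝ, x = ((n : ℝ) - i) / n := ⟨_, rfl⟩
  have hx0 : 0 < x := by rw [hx]; positivity
  have hx1 : x ≤ 1 := by
    rw [hx, div_le_one hn]; linarith [(Nat.cast_nonneg i : (0 : ℝ) ≤ i)]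
  have hix : (i : ℝ) / n = 1 - x := by rw [hx]; field_simp; ring
  have hmain : (n : ℝ) / (d * ((n : ℝ) - i)) = 1 / (d * x) := by
    rw [hx]; field_simp
  obtain ⟨p, hp⟩ : ∃ p : ℝ, p = (i.choose d : ℝ) / (n.choose d : ℝ) := ⟨_, rfl⟩
  have hpow : p ≤ (1 - x) ^ d := by
    rw [hp, ← hix, div_pow, div_le_div_iff₀ hc (by positivity), mul_comm ((i : ℝ) ^ d)]
    exact_mod_cast choose_mul_pow_le i n d hin.le
  have hp1 : p ≤ 1 - x :=
    hpow.trans (pow_le_of_le_one (by linarith) (by linarith) (by omega))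
  have hp2 := hpow.trans (one_sub_pow_le_quad x hx0.le hx1 d)
  have hlow : 1 - p ≤ d * x := by
    obtain ⟨k, rfl⟩ := Nat.exists_eq_add_of_lt hin
    obtain ⟨e, rfl⟩ : ∃ e, d = e + 1 := ⟨d - 1, by omega⟩
    have h1 := choose_union_bound e i (k + 1)
    have h2 := Nat.add_one_mul_choose_eq (i + k) e
    have e1 : i + (k + 1) - 1 = i + k := by omega
    rw [e1, ← add_assoc] at h1
    have h1' : ((i + k + 1).choose (e + 1) : ℝ) ≤
      i.choose (e + 1) + (k + 1) * (i + k).choose e := by exact_mod_cast h1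
    have h2' : ((i : ℝ) + k + 1) * (i + k).choose e = (i + k + 1).choose (e + 1) * (e + 1) := by
      exact_mod_cast h2
    have hN : (0 : ℝ) < (i : ℝ) + k + 1 := by positivity
    have h3 : ((i + k).choose e : ℝ) =
        (i + k + 1).choose (e + 1) * (e + 1) / ((i : ℝ) + k + 1) := by
      rw [← h2']; field_simp
    have h4 : x = ((k : ℝ) + 1) / ((i : ℝ) + k + 1) := by
      rw [hx]; push_cast; congr 1; ring
    rw [hp, h4, sub_le_iff_le_add, ← sub_le_iff_le_add', le_div_iff₀ hc]
    rw [h3] at h1'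
    push_cast
    refine le_trans (le_of_eq ?_) (sub_le_iff_le_add.2 h1')
    field_simp
  rw [hmain, ← hp]
  have hr : 0 < 1 - p := by linarith
  refine ⟨one_div_le_one_div_of_le hr hlow, ?_⟩
  have hdx : 0 < (d : ℝ) * x := by positivity
  have h5 : (1 : ℝ) / (d * x) + d = (1 + d * (d * x)) / (d * x) := by field_simp
  rw [h5, div_le_div_iff₀ hr hdx]
  have h6 : (d : ℝ) * (d * x) * x ≤ d * (d * x) * (1 - p) :=
    mul_le_mul_of_nonneg_left (by linarith) (by positivity)
  nlinarith

theorem S_asymptotics (d : ℕ) (hd : 1 ≤ d) :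
    ∃ C : ℝ, 0 < C ∧ ∀ n : ℕ, d ≤ n → 2 ≤ n →
      |S n d - (n : ℝ) * Real.log n / d| ≤ C * n := by
  refine ⟨d + 1, by positivity, fun n hdn hn => ?_⟩
  have hd1 : (1 : ℝ) ≤ d := by exact_mod_cast hd
  have hd0 : (0 : ℝ) < d := by linarith
  have hn0 : (0 : ℝ) < n := by exact_mod_cast (by omega : 0 < n)
  obtain ⟨H, hH⟩ : ∃ H : ℝ, H = (harmonic n : ℝ) := ⟨_, rfl⟩
  have hsum : ∑ i ∈ Finset.range n, (n : ℝ) / (d * ((n : ℝ) - i)) = n / d * H := by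
    rw [hH, harmonic, ← Finset.sum_range_reflect]
    push_cast
    rw [Finset.mul_sum]
    refine Finset.sum_congr rfl fun j hj => ?_
    have hj' := Finset.mem_range.1 hj
    have : ((n - 1 - j : ℕ) : ℝ) = n - 1 - j := by
      rw [Nat.cast_sub (by omega), Nat.cast_sub (by omega)]; simp
    rw [this]
    have h0 : (n : ℝ) - (n - 1 - j) = j + 1 := by ring
    rw [h0, div_mul_eq_div_div, div_eq_mul_inv (_ / _)]
  have hlo : n / d * H ≤ S n d := by
    rw [← hsum, S]
    exact Finset.sum_le_sum fun i hi => (term_bounds d n i hd hdn (Finset.mem_range.1 hi)).1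
  have hhi : S n d ≤ n / d * H + d * n := by
    have : n / d * H + d * n =
        ∑ i ∈ Finset.range n, ((n : ℝ) / (d * ((n : ℝ) - i)) + d) := by
      rw [Finset.sum_add_distrib, hsum]; simp [mul_comm]
    rw [this, S]
    exact Finset.sum_le_sum fun i hi => (term_bounds d n i hd hdn (Finset.mem_range.1 hi)).2
  have hH1 : Real.log n ≤ H := by
    rw [hH]
    refine le_trans (Real.log_le_log hn0 ?_) (log_add_one_le_harmonic n)
    push_cast; linarith
  have hH2 : H ≤ 1 + Real.log n := by rw [hH]; exact harmonic_le_one_add_log n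
  have hq : (0 : ℝ) ≤ n / d := by positivity
  have hq1 : (n : ℝ) / d ≤ n := div_le_self hn0.le hd1
  have ha := mul_le_mul_of_nonneg_left hH1 hq
  have hb := mul_le_mul_of_nonneg_left hH2 hq
  have he : (n : ℝ) * Real.log n / d = n / d * Real.log n := by ring
  have hdn0 : 0 ≤ (d : ℝ) * n := by positivity
  rw [he, abs_le]
  constructor <;> nlinarith
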